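/- Let Δ_n ⊂ ℝⁿ be a regular n-dimensional simplex whose inscribed Euclidean ball is the unit ball B₂ⁿ centered at the origin. Then Δ_n is in John's position: every ellipsoid (affine image of B₂ⁿ) contained in Δ_n has Lebesgue volume at most vol(B₂ⁿ). -/

import Mathlib

open MeasureTheory RealInnerProductSpace Pointwise

/-- A convex body: compact, convex, with nonempty interior. -/
def IsConvexBody {n : ℕ} (K : Set (EuclideanSpace ℝ (Fin n))) : Prop :=
  IsCompact K ∧ Convex ℝ K ∧ (interior K).Nonempty

/-- An ellipsoid: the image of the unit Euclidean ball under an invertible affine map. -/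
def IsEllipsoid {n : ℕ} (E : Set (EuclideanSpace ℝ (Fin n))) : Prop :=
  ∃ T : EuclideanSpace ℝ (Fin n) ≃ᵃ[ℝ] EuclideanSpace ℝ (Fin n),
    E = T '' (Metric.closedBall 0 1)

/-- A convex body is in John's position if it contains the unit ball and every ellipsoid
contained in it has volume at most that of the unit ball. -/
def InJohnPosition {n : ℕ} (K : Set (EuclideanSpace ℝ (Fin n))) : Prop :=
  Metric.closedBall 0 1 ⊆ K ∧
    ∀ E : Set (EuclideanSpace ℝ (Fin n)), IsEllipsoid E → E ⊆ K →
      volume E ≤ volume (Metric.closedBall (0 : EuclideanSpace ℝ (Fin n)) 1)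

section RegularSimplex

variable {n : ℕ} {u : Fin (n + 1) → EuclideanSpace ℝ (Fin n)}

/-- The squared norm of a linear combination of the normals of a regular simplex. -/
lemma norm_sq_sum_smul_regularSimplex (hn : 1 ≤ n) (hu : ∀ i, ‖u i‖ = 1)
    (huu : ∀ i j, i ≠ j → ⟪u i, u j⟫ = -1 / (n : ℝ)) (c : Fin (n + 1) → ℝ) :
    ‖∑ i, c i • u i‖ ^ 2 = (n + 1) / n * ∑ i, c i ^ 2 - (∑ i, c i) ^ 2 / n := by
  have hn0 : (n : ℝ) ≠ 0 := by positivity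
  have hg : ∀ i j, ⟪u i, u j⟫ = (if i = j then ((n : ℝ) + 1) / n else 0) - 1 / n := by
    intro i j
    split_ifs with h
    · subst h
      rw [real_inner_self_eq_norm_sq, hu]
      field_simp
      ring
    · rw [huu i j h]
      ring
  rw [← real_inner_self_eq_norm_sq]
  calc ⟪∑ i, c i • u i, ∑ j, c j • u j⟫
      = ∑ i, ∑ j, c i * c j * ⟪u i, u j⟫ := by
        rw [sum_inner]
        refine Finset.sum_congr rfl fun i _ => ?_
        rw [inner_sum]
        refine Finset.sum_congr rfl fun j _ => ?_
        rw [real_inner_smul_left, real_inner_smul_right, mul_assoc]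
    _ = ∑ i, ((n + 1) / n * c i ^ 2 - c i * (∑ j, c j) / n) := by
        refine Finset.sum_congr rfl fun i _ => ?_
        simp only [hg, mul_sub, Finset.sum_sub_distrib, mul_ite, mul_zero, Finset.sum_ite_eq,
          Finset.mem_univ, if_true, ← Finset.sum_mul, ← Finset.mul_sum]
        ring
    _ = _ := by
        rw [Finset.sum_sub_distrib, ← Finset.mul_sum, ← Finset.sum_div, ← Finset.sum_mul,
          sq (∑ i, c i)]

lemma sum_regularSimplex_eq_zero (hn : 1 ≤ n) (hu : ∀ i, ‖u i‖ = 1)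
    (huu : ∀ i j, i ≠ j → ⟪u i, u j⟫ = -1 / (n : ℝ)) : ∑ i, u i = 0 := by
  have h := norm_sq_sum_smul_regularSimplex hn hu huu (fun _ => 1)
  have hn0 : (n : ℝ) ≠ 0 := by positivity
  have h0 : ‖∑ i, u i‖ ^ 2 = 0 := by
    simp only [one_smul] at h
    rw [h]
    simp
    field_simp
    ring
  simpa using h0

lemma sum_inner_sq_regularSimplex_le (hn : 1 ≤ n) (hu : ∀ i, ‖u i‖ = 1)
    (huu : ∀ i j, i ≠ j → ⟪u i, u j⟫ = -1 / (n : ℝ)) {v : EuclideanSpace ℝ (Fin n)}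
    (hv : ‖v‖ = 1) : ∑ i, ⟪v, u i⟫ ^ 2 ≤ ((n : ℝ) + 1) / n := by
  set S := ∑ i, ⟪v, u i⟫ ^ 2 with hS
  have hS0 : 0 ≤ S := Finset.sum_nonneg fun i _ => sq_nonneg _
  have hinner : ⟪v, ∑ i, ⟪v, u i⟫ • u i⟫ = S := by
    simp only [inner_sum, inner_smul_right, hS, sq]
  have hnorm := norm_sq_sum_smul_regularSimplex hn hu huu (fun i => ⟪v, u i⟫)
  have hcs := real_inner_le_norm v (∑ i, ⟪v, u i⟫ • u i)
  rw [hinner, hv, one_mul] at hcs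
  have h2 : S ^ 2 ≤ (n + 1) / n * S := by
    calc S ^ 2 ≤ ‖∑ i, ⟪v, u i⟫ • u i‖ ^ 2 := by gcongr
      _ ≤ _ := by
        rw [hnorm]
        have : 0 ≤ (∑ i, ⟪v, u i⟫) ^ 2 / (n : ℝ) := by positivity
        linarith
  rcases hS0.eq_or_lt with h | h
  · rw [← h]
    positivity
  · exact le_of_mul_le_mul_right (by rwa [sq] at h2) h

/-- The normals of a regular simplex form a tight frame, tested on an orthonormal basis. -/
lemma sum_inner_sq_regularSimplex (hn : 1 ≤ n) (hu : ∀ i, ‖u i‖ = 1)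
    (huu : ∀ i j, i ≠ j → ⟪u i, u j⟫ = -1 / (n : ℝ))
    (v : OrthonormalBasis (Fin n) ℝ (EuclideanSpace ℝ (Fin n))) (k : Fin n) :
    ∑ i, ⟪v k, u i⟫ ^ 2 = ((n : ℝ) + 1) / n := by
  have hle : ∀ k ∈ Finset.univ, ∑ i, ⟪v k, u i⟫ ^ 2 ≤ ((n : ℝ) + 1) / n := fun k _ =>
    sum_inner_sq_regularSimplex_le hn hu huu (v.orthonormal.1 k)
  refine (Finset.sum_eq_sum_iff_of_le hle).1 ?_ k (Finset.mem_univ k)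
  have hi : ∀ i, ∑ k, ⟪v k, u i⟫ ^ 2 = 1 := fun i => by
    simpa [hu] using v.sum_sq_norm_inner_right (u i)
  have hn0 : (n : ℝ) ≠ 0 := by positivity
  rw [Finset.sum_comm]
  simp only [hi]
  simp
  field_simp

end RegularSimplex

lemma LinearMap.det_adjoint_real {E : Type*} [NormedAddCommGroup E] [InnerProductSpace ℝ E]
    [FiniteDimensional ℝ E] (L : E →ₗ[ℝ] E) :
    LinearMap.det (LinearMap.adjoint L) = LinearMap.det L := by
  rw [← LinearMap.det_toMatrix (stdOrthonormalBasis ℝ E).toBasis,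
    LinearMap.toMatrix_adjoint, Matrix.det_conjTranspose, LinearMap.det_toMatrix]
  simp

lemma Finset.prod_le_one_of_sum_le_card {ι : Type*} [Fintype ι] {s : ι → ℝ}
    (h0 : ∀ i, 0 ≤ s i) (hs : ∑ i, s i ≤ Fintype.card ι) : ∏ i, s i ≤ 1 :=
  calc ∏ i, s i ≤ ∏ i, Real.exp (s i - 1) :=
        Finset.prod_le_prod (fun i _ => h0 i) fun i _ => by
          linarith [Real.add_one_le_exp (s i - 1)]
    _ = Real.exp (∑ i, s i - Fintype.card ι) := by
        rw [← Real.exp_sum]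
        simp
    _ ≤ 1 := Real.exp_le_one_iff.2 (by linarith)

/-- A linear map whose adjoint is small on average on the normals of a regular simplex does not
increase volume. -/
lemma abs_det_le_one_of_sum_norm_adjoint_le {n : ℕ} (hn : 1 ≤ n)
    {u : Fin (n + 1) → EuclideanSpace ℝ (Fin n)} (hu : ∀ i, ‖u i‖ = 1)
    (huu : ∀ i j, i ≠ j → ⟪u i, u j⟫ = -1 / (n : ℝ))
    (L : EuclideanSpace ℝ (Fin n) →ₗ[ℝ] EuclideanSpace ℝ (Fin n))
    (hL : ∑ i, ‖LinearMap.adjoint L (u i)‖ ≤ n + 1) : |LinearMap.det L| ≤ 1 := by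
  have hpos := LinearMap.isPositive_self_comp_adjoint L
  have hfr : Module.finrank ℝ (EuclideanSpace ℝ (Fin n)) = n := by simp
  have hsymm := hpos.isSymmetric
  set v := hsymm.eigenvectorBasis hfr
  set l := hsymm.eigenvalues hfr
  have hl : ∀ k, 0 ≤ l k := hpos.nonneg_eigenvalues hfr
  have hn0 : (0 : ℝ) < n := by positivity
  have hnorm : ∀ w, ‖LinearMap.adjoint L w‖ ^ 2 = ∑ k, l k * ⟪v k, w⟫ ^ 2 := by
    intro w
    rw [← real_inner_self_eq_norm_sq, LinearMap.adjoint_inner_left, real_inner_comm,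
      ← LinearMap.comp_apply, ← v.sum_inner_mul_inner]
    refine Finset.sum_congr rfl fun k _ => ?_
    rw [hsymm, hsymm.apply_eigenvectorBasis hfr, inner_smul_right, real_inner_comm]
    simp only [RCLike.ofReal_real_eq_id, id_eq]
    ring
  have hlow : ∀ i, ∑ k, √(l k) * ⟪v k, u i⟫ ^ 2 ≤ ‖LinearMap.adjoint L (u i)‖ := by
    intro i
    refine le_of_sq_le_sq ?_ (norm_nonneg _)
    have h1 : ∑ k, ⟪v k, u i⟫ ^ 2 = 1 := by
      simpa [hu] using v.sum_sq_norm_inner_right (u i)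
    have h := Finset.sum_mul_sq_le_sq_mul_sq Finset.univ
      (fun k => √(l k) * ⟪v k, u i⟫) (fun k => ⟪v k, u i⟫)
    simp only [mul_pow, Real.sq_sqrt (hl _)] at h
    rw [h1, mul_one, ← hnorm] at h
    simpa only [sq, mul_assoc] using h
  have hsum : ∑ k, √(l k) ≤ n := by
    have h : ∑ i, ∑ k, √(l k) * ⟪v k, u i⟫ ^ 2 ≤ n + 1 :=
      (Finset.sum_le_sum fun i _ => hlow i).trans hL
    rw [Finset.sum_comm] at h
    simp only [← Finset.mul_sum, sum_inner_sq_regularSimplex hn hu huu v] at h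
    rw [← Finset.sum_mul, ← mul_div_assoc, div_le_iff₀ hn0] at h
    nlinarith
  have hprod : ∏ k, √(l k) ≤ 1 :=
    Finset.prod_le_one_of_sum_le_card (fun k => Real.sqrt_nonneg _) (by simpa using hsum)
  have hdet : LinearMap.det L ^ 2 = (∏ k, √(l k)) ^ 2 := by
    have h := hsymm.det_eq_prod_eigenvalues hfr
    rw [LinearMap.det_comp, LinearMap.det_adjoint_real] at h
    rw [sq, h, ← Finset.prod_pow]
    exact Finset.prod_congr rfl fun k _ => (Real.sq_sqrt (hl k)).symm
  rw [← sq_le_one_iff_abs_le_one, hdet]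
  exact pow_le_one₀ (Finset.prod_nonneg fun k _ => Real.sqrt_nonneg _) hprod

/-- The support function of the image of the unit ball under a linear map. -/
lemma norm_adjoint_le_of_forall_closedBall {E : Type*} [NormedAddCommGroup E]
    [InnerProductSpace ℝ E] [FiniteDimensional ℝ E] (L : E →ₗ[ℝ] E) (w : E) (a : ℝ)
    (h : ∀ x ∈ Metric.closedBall (0 : E) 1, ⟪L x, w⟫ ≤ a) : ‖LinearMap.adjoint L w‖ ≤ a := by
  set y := LinearMap.adjoint L w with hy
  have hx := h (‖y‖⁻¹ • y) (by
    rw [mem_closedBall_zero_iff, norm_smul, norm_inv, norm_norm]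
    exact inv_mul_le_one)
  rw [← LinearMap.adjoint_inner_right, ← hy, inner_smul_left, real_inner_self_eq_norm_sq] at hx
  rcases eq_or_ne ‖y‖ 0 with h0 | h0
  · simpa [h0] using hx
  · calc ‖y‖ = ‖y‖⁻¹ * ‖y‖ ^ 2 := by field_simp
      _ ≤ a := hx

theorem regular_simplex_in_john_position
    {n : ℕ} (hn : 1 ≤ n) (u : Fin (n + 1) → EuclideanSpace ℝ (Fin n))
    (hu : ∀ i, ‖u i‖ = 1)
    (huu : ∀ i j, i ≠ j → ⟪u i, u j⟫ = -1 / (n : ℝ)) :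
    InJohnPosition {x : EuclideanSpace ℝ (Fin n) | ∀ i, ⟪x, u i⟫ ≤ 1} := by
  refine ⟨fun x hx i => ?_, ?_⟩
  · have h := real_inner_le_norm x (u i)
    rw [hu, mul_one] at h
    exact h.trans (mem_closedBall_zero_iff.1 hx)
  rintro E ⟨T, rfl⟩ hE
  set L : EuclideanSpace ℝ (Fin n) →ₗ[ℝ] EuclideanSpace ℝ (Fin n) :=
    T.linear.toLinearMap
  have hT : ∀ x, T x = T 0 + L x := fun x => by
    have h := congrFun (T : EuclideanSpace ℝ (Fin n) →ᵃ[ℝ] EuclideanSpace ℝ (Fin n)).decomp x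
    rw [add_comm]
    exact h
  have hadj : ∀ i, ‖LinearMap.adjoint L (u i)‖ ≤ 1 - ⟪T 0, u i⟫ := fun i =>
    norm_adjoint_le_of_forall_closedBall L (u i) _ fun x hx => by
      have h := hE (Set.mem_image_of_mem T hx) i
      rw [hT x, inner_add_left] at h
      linarith
  have hsum : ∑ i, ‖LinearMap.adjoint L (u i)‖ ≤ n + 1 :=
    calc ∑ i, ‖LinearMap.adjoint L (u i)‖ ≤ ∑ i, (1 - ⟪T 0, u i⟫) :=
          Finset.sum_le_sum fun i _ => hadj i
      _ = n + 1 := by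
          rw [Finset.sum_sub_distrib, ← inner_sum, sum_regularSimplex_eq_zero hn hu huu]
          simp
  have himage : T '' Metric.closedBall 0 1 = T 0 +ᵥ (L '' Metric.closedBall 0 1) := by
    rw [← Set.image_vadd, Set.image_image]
    exact Set.image_congr fun x _ => hT x
  rw [himage, measure_vadd, Measure.addHaar_image_linearMap]
  refine mul_le_of_le_one_left zero_le (ENNReal.ofReal_le_one.2 ?_)
  exact abs_det_le_one_of_sum_norm_adjoint_le hn hu huu L hsum
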